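/- arXiv:1803.04233 — 2 statements merged into one kernel-verified Lean document; each statement's English description precedes it below -/
import Mathlib

section
/- Let d ≥ 1, V : ℝ^d → ℝ smooth, and let f, g : ℝ^d → ℝ be smooth with f compactly supported. Then the weighted Green (integration by parts) formula on the half-space holds: ∫_H g (Lf) dμ = − ∫_H ⟨∇f, ∇g⟩ dμ − ∫_{ℝ^{d−1}} g(x̂,0) ∂_d f(x̂,0) dμ_∂. -/
open MeasureTheory Real

/-- Partial derivative `∂ᵢ f` on `ℝ^n = Fin n → ℝ`. -/
noncomputable def pd {n : ℕ} (i : Fin n) (f : (Fin n → ℝ) → ℝ) (x : Fin n → ℝ) : ℝ :=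
  fderiv ℝ f x (Pi.single i 1)

/-- Hessian entry `∂ᵢ∂ⱼ f`. -/
noncomputable def hess {n : ℕ} (i j : Fin n) (f : (Fin n → ℝ) → ℝ) (x : Fin n → ℝ) : ℝ :=
  pd i (pd j f) x

/-- Euclidean Laplacian `Δf`. -/
noncomputable def lap {n : ℕ} (f : (Fin n → ℝ) → ℝ) (x : Fin n → ℝ) : ℝ :=
  ∑ i, hess i i f x

/-- Weighted Laplacian `L f = Δ f + ⟨∇V, ∇f⟩`. -/
noncomputable def Lop {n : ℕ} (V f : (Fin n → ℝ) → ℝ) (x : Fin n → ℝ) : ℝ :=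
  lap f x + ∑ i, pd i V x * pd i f x

/-- Squared Hilbert-Schmidt norm of the Hessian of `f`. -/
noncomputable def hessHS2 {n : ℕ} (f : (Fin n → ℝ) → ℝ) (x : Fin n → ℝ) : ℝ :=
  ∑ i, ∑ j, (hess i j f x) ^ 2

/-- The Hessian of `V` as a bilinear form evaluated at vectors `u, v`. -/
noncomputable def hessBil {n : ℕ} (V : (Fin n → ℝ) → ℝ) (x : Fin n → ℝ)
    (u v : Fin n → ℝ) : ℝ :=
  ∑ i, ∑ j, hess i j V x * u i * v j

/-- The gradient `∇f`. -/
noncomputable def grad {n : ℕ} (f : (Fin n → ℝ) → ℝ) (x : Fin n → ℝ) : Fin n → ℝ :=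
  fun i => pd i f x

/-- The closed upper half-space `H = {x ∈ ℝ^{d+1} : x_{d+1} ≥ 0}`. -/
def upperHalf (d : ℕ) : Set (Fin (d + 1) → ℝ) := {x | 0 ≤ x (Fin.last d)}

theorem tsupport_pd_subset {n : ℕ} (f : (Fin n → ℝ) → ℝ) (i : Fin n) :
    tsupport (pd i f) ⊆ tsupport f :=
  tsupport_fderiv_apply_subset ℝ _

theorem pd_of_notMem_tsupport {n : ℕ} {f : (Fin n → ℝ) → ℝ} {x : Fin n → ℝ}
    (hx : x ∉ tsupport f) (i : Fin n) : pd i f x = 0 :=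
  image_eq_zero_of_notMem_tsupport fun h => hx (tsupport_pd_subset f i h)

/-- The divergence theorem on the half-space for compactly supported `C¹` vector fields. -/
theorem setIntegral_upperHalf_divergence {d : ℕ}
    (X : Fin (d + 1) → (Fin (d + 1) → ℝ) → ℝ) (hX : ∀ i, ContDiff ℝ 1 (X i))
    (hc : ∀ i, HasCompactSupport (X i)) :
    ∫ x in upperHalf d, ∑ i, pd i (X i) x = -∫ xb : Fin d → ℝ, X (Fin.last d) (Fin.snoc xb 0) := by
  obtain ⟨R, hR0, hR⟩ : ∃ R : ℝ, 0 < R ∧ ∀ i x, R ≤ ‖x‖ → x ∉ tsupport (X i) := by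
    obtain ⟨R, hR⟩ := (isCompact_iUnion hc).isBounded.subset_ball 0
    refine ⟨max R 1, by positivity, fun i x hx hxi => ?_⟩
    have hxR := hR (Set.mem_iUnion_of_mem i hxi)
    rw [mem_ball_zero_iff] at hxR
    exact absurd hxR (not_lt.2 ((le_max_left _ _).trans hx))
  have hX0 : ∀ i x, R ≤ ‖x‖ → X i x = 0 := fun i x hx =>
    image_eq_zero_of_notMem_tsupport (hR i x hx)
  let a : Fin (d + 1) → ℝ := Fin.snoc (fun _ : Fin d => -R) 0
  let b : Fin (d + 1) → ℝ := fun _ => R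
  have ha : ∀ j : Fin d, a j.castSucc = -R := fun j => Fin.snoc_castSucc _ _ j
  have ha' : a (Fin.last d) = 0 := Fin.snoc_last _ _
  have hle : a ≤ b := fun j => by
    refine Fin.lastCases ?_ (fun j => ?_) j
    · rw [ha']; exact hR0.le
    · rw [ha]; exact (neg_lt_self hR0).le
  have hcd : Continuous fun x => ∑ i, pd i (X i) x :=
    continuous_finsetSum _ fun i _ => ((hX i).continuous_fderiv one_ne_zero).clm_apply
      continuous_const
  have hdiv := integral_divergence_of_hasFDerivAt_off_countable' a b hle X
    (fun i => fderiv ℝ (X i)) ∅ Set.countable_empty (fun i => (hX i).continuous.continuousOn)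
    (fun x _ i => ((hX i).differentiable one_ne_zero x).hasFDerivAt)
    (hcd.continuousOn.integrableOn_compact isCompact_Icc)
  have hH : ∫ x in upperHalf d, ∑ i, pd i (X i) x = ∫ x in Set.Icc a b, ∑ i, pd i (X i) x := by
    have hmeas : MeasurableSet (upperHalf d) :=
      measurableSet_le measurable_const (measurable_pi_apply _)
    refine setIntegral_eq_of_subset_of_forall_sdiff_eq_zero hmeas
      (fun x hx => ha'.symm.le.trans (hx.1 (Fin.last d))) fun x ⟨hx, hxI⟩ => ?_
    refine Finset.sum_eq_zero fun i _ =>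
      pd_of_notMem_tsupport (hR i x (not_lt.1 fun hlt => hxI ?_)) i
    have hxj : ∀ j, |x j| < R := fun j => (norm_le_pi_norm x j).trans_lt hlt
    refine ⟨fun j => ?_, fun j => (abs_lt.1 (hxj j)).2.le⟩
    refine Fin.lastCases ?_ (fun j => ?_) j
    · rw [ha']; exact hx
    · rw [ha]; exact (abs_lt.1 (hxj _)).1.le
  have hface : ∀ (i : Fin (d + 1)) (c : ℝ) (s : Set (Fin d → ℝ)), R ≤ |c| →
      ∫ x in s, X i (i.insertNth c x) = 0 := fun i c s hRc => by
    refine integral_eq_zero_of_ae (.of_forall fun x => hX0 i _ (hRc.trans ?_))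
    simpa using norm_le_pi_norm (i.insertNth c x : Fin (d + 1) → ℝ) i
  rw [hH]
  refine hdiv.trans ?_
  rw [Fin.sum_univ_castSucc, Finset.sum_eq_zero, zero_add, hface _ _ _ (le_abs_self R), zero_sub,
    setIntegral_eq_integral_of_forall_compl_eq_zero]
  · simp only [ha', Fin.insertNth_last']
  · intro x hx
    refine hX0 _ _ (not_lt.1 fun hlt => hx ?_)
    have hxj : ∀ j, |x j| < R := fun j => by
      have := (norm_le_pi_norm _ j.castSucc).trans_lt hlt
      simpa [Fin.insertNth_last'] using this
    refine ⟨fun j => ?_, fun j => (abs_lt.1 (hxj j)).2.le⟩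
    simpa [ha] using (abs_lt.1 (hxj j)).1.le
  · intro j _
    rw [hface _ _ _ (le_abs_self R), hface _ _ _ (by rw [ha, abs_neg]; exact le_abs_self R),
      sub_self]

theorem contDiff_pd {n : ℕ} {f : (Fin n → ℝ) → ℝ} (hf : ContDiff ℝ (⊤ : ℕ∞) f) (i : Fin n) :
    ContDiff ℝ (⊤ : ℕ∞) (pd i f) :=
  (hf.fderiv_right (by simp)).clm_apply contDiff_const

theorem pd_mul {n : ℕ} {f g : (Fin n → ℝ) → ℝ} {x : Fin n → ℝ} (hf : DifferentiableAt ℝ f x)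
    (hg : DifferentiableAt ℝ g x) (i : Fin n) :
    pd i (fun y => f y * g y) x = f x * pd i g x + g x * pd i f x := by
  simp [pd, fderiv_fun_mul hf hg]

theorem pd_exp {n : ℕ} {V : (Fin n → ℝ) → ℝ} {x : Fin n → ℝ} (hV : DifferentiableAt ℝ V x)
    (i : Fin n) : pd i (fun y => exp (V y)) x = exp (V x) * pd i V x := by
  simp [pd, fderiv_exp hV]

/-- the weighted Green (integration by parts) formula on the half-space:
`∫_H g (Lf) dμ = − ∫_H ⟨∇f, ∇g⟩ dμ − ∫_{ℝ^{d−1}} g(xb,0) ∂_d f(xb,0) dμ_∂`,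
where `μ = e^V dx` and `μ_∂ = e^{V(xb,0)} dxb`.  (Here the ambient dimension `d + 1 ≥ 1`.) -/
theorem green_formula_half_space
    (d : ℕ) (V f g : (Fin (d + 1) → ℝ) → ℝ)
    (hV : ContDiff ℝ (⊤ : ℕ∞) V) (hf : ContDiff ℝ (⊤ : ℕ∞) f) (hg : ContDiff ℝ (⊤ : ℕ∞) g)
    (hfc : HasCompactSupport f) :
    ∫ x in upperHalf d, g x * Lop V f x * exp (V x)
      = -(∫ x in upperHalf d, (∑ i, pd i f x * pd i g x) * exp (V x))
        - ∫ xb : Fin d → ℝ,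
            g (Fin.snoc xb 0) * pd (Fin.last d) f (Fin.snoc xb 0)
              * exp (V (Fin.snoc xb 0)) := by
  have hc : ∀ i, HasCompactSupport (pd i f) := fun i => hfc.fderiv_apply ℝ _
  have hf' := contDiff_pd hf
  have hdg := hg.differentiable (by simp)
  have hdV := hV.differentiable (by simp)
  have hdf' := fun i => (hf' i).differentiable (by simp)
  have hL : Integrable fun x => g x * Lop V f x * exp (V x) := by
    refine Continuous.integrable_of_hasCompactSupport ?_ ?_
    · have h1 := fun i => (contDiff_pd (hf' i) i).continuous
      have h2 := fun i => (hf' i).continuous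
      have h3 := fun i => (contDiff_pd hV i).continuous
      have h4 := hg.continuous
      have h5 := hV.continuous
      unfold Lop lap hess
      fun_prop
    · refine .intro hfc fun x hx => ?_
      have hx' := fun i => pd_of_notMem_tsupport hx i
      have hx'' := fun i =>
        pd_of_notMem_tsupport (fun h => hx (tsupport_pd_subset f i h)) i
      simp [Lop, lap, hess, hx', hx'']
  have hG : Integrable fun x => (∑ i, pd i f x * pd i g x) * exp (V x) := by
    refine Continuous.integrable_of_hasCompactSupport ?_ ?_
    · have h2 := fun i => (hf' i).continuous
      have h3 := fun i => (contDiff_pd hg i).continuous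
      have h5 := hV.continuous
      fun_prop
    · exact .intro hfc fun x hx => by simp [pd_of_notMem_tsupport hx]
  have hdiv := setIntegral_upperHalf_divergence
    (fun i x => g x * pd i f x * exp (V x))
    (fun i => ((hg.mul (hf' i)).mul hV.exp).of_le (by simp))
    (fun i => ((hc i).mul_left).mul_right)
  have hpt : ∀ x, ∑ i, pd i (fun y => g y * pd i f y * exp (V y)) x =
      g x * Lop V f x * exp (V x) + (∑ i, pd i f x * pd i g x) * exp (V x) := fun x => by
    simp only [Lop, lap, hess, ← Finset.sum_add_distrib, Finset.mul_sum, Finset.sum_mul]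
    refine Finset.sum_congr rfl fun i _ => ?_
    rw [pd_mul ((hdg x).fun_mul (hdf' i x)) (hdV x).exp, pd_mul (hdg x) (hdf' i x), pd_exp (hdV x)]
    ring
  simp only [hpt] at hdiv
  rw [integral_add hL.integrableOn hG.integrableOn] at hdiv
  linarith
end

section
/- Let U ⊆ ℝ^d be open and let Q : U → Sym_d(ℝ) be a continuous field of symmetric d×d real matrices. If ∫_U ⟨Q(x) ∇f(x), ∇f(x)⟩ dx ≥ 0 for every f ∈ C_c^∞(U), then Q(x) is positive semidefinite for every x ∈ U. -/
open MeasureTheory Real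

/-- A function continuous on `U` and vanishing off a compact subset of `U` is integrable on `U`. -/
theorem integrableOn_of_continuousOn_of_eq_zero {n : ℕ} {U K : Set (Fin n → ℝ)}
    {g : (Fin n → ℝ) → ℝ} (hK : IsCompact K) (hKU : K ⊆ U) (hg : ContinuousOn g U)
    (h0 : ∀ x, x ∉ K → g x = 0) : IntegrableOn g U :=
  ((integrableOn_iff_integrable_of_support_subset fun x hx => by
    by_contra h
    exact hx (h0 x h)).1 ((hg.mono hKU).integrableOn_compact hK)).integrableOn

theorem pd_eq_zero_of_notMem_tsupport {n : ℕ} (i : Fin n) {f : (Fin n → ℝ) → ℝ} {x : Fin n → ℝ}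
    (hx : x ∉ tsupport f) : pd i f x = 0 := by
  simp [pd, fderiv_of_notMem_tsupport ℝ hx]

theorem continuous_pd {n : ℕ} (i : Fin n) {f : (Fin n → ℝ) → ℝ} (hf : ContDiff ℝ (⊤ : ℕ∞) f) :
    Continuous (pd i f) :=
  (hf.continuous_fderiv (by simp)).clm_apply continuous_const

/-- The energy integrand of a test function is integrable. -/
theorem integrableOn_quadratic_pd {n : ℕ} {U : Set (Fin n → ℝ)}
    {Q : (Fin n → ℝ) → Matrix (Fin n) (Fin n) ℝ} (hQ : ContinuousOn Q U)
    {f : (Fin n → ℝ) → ℝ} (hf : ContDiff ℝ (⊤ : ℕ∞) f) (hc : HasCompactSupport f)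
    (hU : tsupport f ⊆ U) :
    IntegrableOn (fun x => ∑ i, ∑ j, Q x i j * pd i f x * pd j f x) U := by
  refine integrableOn_of_continuousOn_of_eq_zero hc hU ?_ fun x hx => ?_
  · refine continuousOn_finsetSum _ fun i _ => continuousOn_finsetSum _ fun j _ => ?_
    have hij : ContinuousOn (fun x => Q x i j) U :=
      (continuous_apply_apply (ρ := fun _ _ => ℝ) i j).comp_continuousOn hQ
    exact (hij.mul (continuous_pd i hf).continuousOn).mul (continuous_pd j hf).continuousOn
  · simp [pd_eq_zero_of_notMem_tsupport _ hx]

/-- Derivative of a plane-wave modulation `x ↦ φ x * s ⟨v, x⟩`. -/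
theorem pd_mul_comp_dotProduct {n : ℕ} (i : Fin n) {φ : (Fin n → ℝ) → ℝ} {s : ℝ → ℝ} {s' : ℝ}
    (v x : Fin n → ℝ) (hφ : DifferentiableAt ℝ φ x) (hs : HasDerivAt s s' (v ⬝ᵥ x)) :
    pd i (fun y => φ y * s (v ⬝ᵥ y)) x = pd i φ x * s (v ⬝ᵥ x) + φ x * v i * s' := by
  let L : (Fin n → ℝ) →L[ℝ] ℝ := (dotProductBilin ℝ ℝ v).toContinuousLinearMap
  have hL : HasFDerivAt (fun y => v ⬝ᵥ y) L x := L.hasFDerivAt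
  have h := hφ.hasFDerivAt.mul (hs.comp_hasFDerivAt x hL)
  have h' : fderiv ℝ (fun y => φ y * s (v ⬝ᵥ y)) x = _ := h.fderiv
  have hLi : L (Pi.single i 1) = v i := by
    change v ⬝ᵥ Pi.single i 1 = v i
    simp
  simp only [pd, h', add_apply, smul_apply, hLi,
    smul_eq_mul, Function.comp_apply]
  ring

/-- Testing with `φ cos ⟨v, ·⟩` and `φ sin ⟨v, ·⟩` and adding up cancels the cross terms. -/
theorem integral_quadratic_pd_add_nonneg {n : ℕ} {U : Set (Fin n → ℝ)}
    {Q : (Fin n → ℝ) → Matrix (Fin n) (Fin n) ℝ} (hQ : ContinuousOn Q U)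
    (hpos : ∀ f : (Fin n → ℝ) → ℝ, ContDiff ℝ (⊤ : ℕ∞) f → HasCompactSupport f →
      tsupport f ⊆ U → 0 ≤ ∫ x in U, ∑ i, ∑ j, Q x i j * pd i f x * pd j f x)
    {φ : (Fin n → ℝ) → ℝ} (hφ : ContDiff ℝ (⊤ : ℕ∞) φ) (hc : HasCompactSupport φ)
    (hU : tsupport φ ⊆ U) (v : Fin n → ℝ) :
    0 ≤ ∫ x in U, ((∑ i, ∑ j, Q x i j * pd i φ x * pd j φ x) +
      φ x ^ 2 * (v ⬝ᵥ (Q x).mulVec v)) := by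
  have hlin : ContDiff ℝ (⊤ : ℕ∞) (fun x : Fin n → ℝ => v ⬝ᵥ x) := by
    unfold dotProduct
    fun_prop
  have hmod {s : ℝ → ℝ} (hs : ContDiff ℝ (⊤ : ℕ∞) s) :
      ContDiff ℝ (⊤ : ℕ∞) (fun x => φ x * s (v ⬝ᵥ x)) ∧
      HasCompactSupport (fun x => φ x * s (v ⬝ᵥ x)) ∧
      tsupport (fun x => φ x * s (v ⬝ᵥ x)) ⊆ U :=
    ⟨hφ.mul (hs.comp hlin), hc.mul_right, (tsupport_mul_subset_left (f := φ)).trans hU⟩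
  obtain ⟨hs₁, hs₂, hs₃⟩ := hmod Real.contDiff_sin
  obtain ⟨hc₁, hc₂, hc₃⟩ := hmod Real.contDiff_cos
  have h := add_nonneg (hpos _ hs₁ hs₂ hs₃) (hpos _ hc₁ hc₂ hc₃)
  rw [← integral_add (integrableOn_quadratic_pd hQ hs₁ hs₂ hs₃)
    (integrableOn_quadratic_pd hQ hc₁ hc₂ hc₃)] at h
  refine h.trans_eq (integral_congr_ae (Filter.Eventually.of_forall fun x => ?_))
  have hd : DifferentiableAt ℝ φ x := (hφ.differentiable (by simp)).differentiableAt
  simp only [pd_mul_comp_dotProduct _ v x hd (Real.hasDerivAt_sin _),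
    pd_mul_comp_dotProduct _ v x hd (Real.hasDerivAt_cos _)]
  simp only [dotProduct, Matrix.mulVec, Finset.mul_sum, ← Finset.sum_add_distrib]
  refine Finset.sum_congr rfl fun i _ => Finset.sum_congr rfl fun j _ => ?_
  linear_combination (Q x i j * pd i φ x * pd j φ x + φ x ^ 2 * (v i * (Q x i j * v j))) *
    Real.sin_sq_add_cos_sq (∑ k, v k * x k)

/-- if `Q` is a continuous field of symmetric matrices on an open set
`U ⊆ ℝ^d` and `∫_U ⟨Q ∇f, ∇f⟩ dx ≥ 0` for every `f ∈ C_c^∞(U)`, then `Q(x)` is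
positive semidefinite for every `x ∈ U`. -/
theorem matrix_field_nonneg_of_integral_nonneg
    (d : ℕ) (U : Set (Fin d → ℝ)) (hU : IsOpen U)
    (Q : (Fin d → ℝ) → Matrix (Fin d) (Fin d) ℝ)
    (hQc : ContinuousOn Q U)
    (hQs : ∀ x ∈ U, (Q x).IsSymm)
    (hpos : ∀ f : (Fin d → ℝ) → ℝ, ContDiff ℝ (⊤ : ℕ∞) f → HasCompactSupport f →
      tsupport f ⊆ U →
      0 ≤ ∫ x in U, ∑ i, ∑ j, Q x i j * pd i f x * pd j f x) :
    ∀ x ∈ U, (Q x).PosSemidef := by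
  intro x₀ hx₀
  refine Matrix.PosSemidef.of_dotProduct_mulVec_nonneg (hQs x₀ hx₀) fun v => ?_
  rw [star_trivial]
  by_contra! hneg
  set q : (Fin d → ℝ) → ℝ := fun x => v ⬝ᵥ (Q x).mulVec v with hq
  have hqc : ContinuousOn q U :=
    (continuous_const.dotProduct (continuous_id.matrix_mulVec continuous_const)).comp_continuousOn
      hQc
  have hnhds : U ∩ q ⁻¹' Set.Iio 0 ∈ nhds x₀ :=
    (hqc.isOpen_inter_preimage hU isOpen_Iio).mem_nhds ⟨hx₀, hneg⟩
  obtain ⟨r, hr, hrU⟩ := Metric.nhds_basis_closedBall.mem_iff.1 hnhds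
  let φ : ContDiffBump x₀ := ⟨r / 2, r, half_pos hr, half_lt_self hr⟩
  have hφ : ContDiff ℝ (⊤ : ℕ∞) φ := φ.contDiff
  have hsub : tsupport φ ⊆ U := by
    rw [φ.tsupport_eq]
    exact fun x hx => (hrU hx).1
  have hI := integrableOn_quadratic_pd hQc hφ φ.hasCompactSupport hsub
  have hJ : IntegrableOn (fun x => φ x ^ 2 * q x) U :=
    integrableOn_of_continuousOn_of_eq_zero φ.hasCompactSupport hsub
      ((φ.continuous.pow 2).continuousOn.mul hqc) fun x hx => by
        simp [image_eq_zero_of_notMem_tsupport hx]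
  set A := ∫ x in U, ∑ i, ∑ j, Q x i j * pd i φ x * pd j φ x
  set B := ∫ x in U, φ x ^ 2 * q x
  have hqneg : ∀ x ∈ Metric.ball x₀ r, φ x ^ 2 * q x < 0 := fun x hx =>
    mul_neg_of_pos_of_neg (pow_pos (φ.pos_of_mem_ball hx) 2)
      (hrU (Metric.ball_subset_closedBall hx)).2
  have hBneg : B < 0 := by
    have hpos' : 0 < ∫ x in U, -(φ x ^ 2 * q x) := by
      refine (integral_pos_iff_support_of_nonneg (fun x => ?_) hJ.neg).2 ?_
      · by_cases hx : x ∈ Metric.ball x₀ r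
        · exact neg_nonneg.2 (hqneg x hx).le
        · have : φ x = 0 := φ.zero_of_le_dist (not_lt.1 hx)
          simp [this]
      · have hball : Metric.ball x₀ r ⊆ U := fun x hx =>
          (hrU (Metric.ball_subset_closedBall hx)).1
        refine (Metric.measure_ball_pos volume x₀ hr).trans_le ?_
        rw [← Measure.restrict_eq_self volume hball]
        exact measure_mono fun x hx => neg_ne_zero.2 (hqneg x hx).ne
    rw [integral_neg] at hpos'
    linarith
  set t := √((|A| + 1) / -B)
  have ht : t ^ 2 * B = -(|A| + 1) := by
    rw [Real.sq_sqrt (div_nonneg (by positivity) (by linarith))]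
    field_simp [hBneg.ne]
  have key := integral_quadratic_pd_add_nonneg hQc hpos hφ φ.hasCompactSupport hsub (t • v)
  have hscale (x : Fin d → ℝ) :
      φ x ^ 2 * ((t • v) ⬝ᵥ (Q x).mulVec (t • v)) = t ^ 2 * (φ x ^ 2 * q x) := by
    simp only [hq, Matrix.mulVec_smul, smul_dotProduct, dotProduct_smul, smul_eq_mul]
    ring
  simp only [hscale] at key
  rw [integral_add hI (hJ.const_mul _), integral_const_mul] at key
  linarith [le_abs_self A]
end
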